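/- arXiv:cs/0204052 — 3 statements merged into one kernel-verified Lean document; each statement's English description precedes it below -/
import Mathlib

section
/- Let Ω = Ω_1 × ⋯ × Ω_n be a product of nonempty finite sets and let G be a directed acyclic graph on the nodes {1,…,n} consistent with the ordering (every edge i→j has i < j) with in-degree at most Δ (every node has at most Δ parents). If P and Q are strictly positive probability measures on Ω that are both Markov relative to G, and for every subset J ⊆ {1,…,n} with |J| ≤ Δ+1 the marginal distributions of P and Q on the coordinates in J coincide, then P = Q. -/
/-- The marginal probability, under a finitely supported distribution `P` on the
product `Ω = Ω_1 × ⋯ × Ω_n`, of the event that all coordinates in `J` take the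
values prescribed by `x`. -/
def marg {n : ℕ} {Ω : Fin n → Type*} [∀ i, Fintype (Ω i)] [∀ i, DecidableEq (Ω i)]
    (P : (∀ i, Ω i) → ℝ) (J : Finset (Fin n)) (x : ∀ i, Ω i) : ℝ :=
  ∑ y : ∀ i, Ω i, if ∀ i ∈ J, y i = x i then P y else 0

/-- `P` is Markov relative to the DAG with parent sets `Pa`: for every point `x`,
`P(x) = ∏_j P(x_j | pa_j)`, written in cross-multiplied form (the conditional
probabilities are quotients of marginals, and `P` is strictly positive in all
applications, so all denominators are positive). -/
def IsMarkov {n : ℕ} {Ω : Fin n → Type*} [∀ i, Fintype (Ω i)] [∀ i, DecidableEq (Ω i)]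
    (P : (∀ i, Ω i) → ℝ) (Pa : Fin n → Finset (Fin n)) : Prop :=
  ∀ x : ∀ i, Ω i,
    P x * ∏ j, marg P (Pa j) x = ∏ j, marg P (insert j (Pa j)) x

theorem marg_pos {n : ℕ} {Ω : Fin n → Type*} [∀ i, Fintype (Ω i)] [∀ i, DecidableEq (Ω i)]
    {P : (∀ i, Ω i) → ℝ} (hP : ∀ x, 0 < P x) (J : Finset (Fin n)) (x : ∀ i, Ω i) :
    0 < marg P J x := by
  refine Finset.sum_pos' (fun y _ => ?_) ⟨x, Finset.mem_univ x, ?_⟩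
  · split_ifs
    exacts [(hP y).le, le_rfl]
  · simpa using hP x

/-- If two strictly positive probability measures on
`Ω = Ω_1 × ⋯ × Ω_n` are both Markov relative to the same ordering-consistent DAG
of in-degree at most `Δ`, and their marginals on all coordinate sets of size at
most `Δ + 1` coincide, then the two measures are equal. -/
theorem tuple_marginals_determine_measure
    {n Δ : ℕ} {Ω : Fin n → Type*} [∀ i, Fintype (Ω i)] [∀ i, Nonempty (Ω i)]
    [∀ i, DecidableEq (Ω i)]
    (Pa : Fin n → Finset (Fin n))
    (horder : ∀ j : Fin n, ∀ i ∈ Pa j, i < j)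
    (hdeg : ∀ j : Fin n, (Pa j).card ≤ Δ)
    (P Q : (∀ i, Ω i) → ℝ)
    (hPpos : ∀ x, 0 < P x) (hQpos : ∀ x, 0 < Q x)
    (hPsum : ∑ x, P x = 1) (hQsum : ∑ x, Q x = 1)
    (hPMarkov : IsMarkov P Pa) (hQMarkov : IsMarkov Q Pa)
    (hmarg : ∀ J : Finset (Fin n), J.card ≤ Δ + 1 → ∀ x, marg P J x = marg Q J x) :
    P = Q := by
  funext x
  have hPa : ∏ j, marg P (Pa j) x = ∏ j, marg Q (Pa j) x :=
    Finset.prod_congr rfl fun j _ => hmarg _ ((hdeg j).trans (Nat.le_succ Δ)) x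
  have hfam : ∏ j, marg P (insert j (Pa j)) x = ∏ j, marg Q (insert j (Pa j)) x :=
    Finset.prod_congr rfl fun j _ =>
      hmarg _ ((Finset.card_insert_le _ _).trans (Nat.succ_le_succ (hdeg j))) x
  have hpos : 0 < ∏ j, marg Q (Pa j) x :=
    Finset.prod_pos fun j _ => marg_pos hQpos (Pa j) x
  apply mul_right_cancel₀ hpos.ne'
  rw [hQMarkov x, ← hPa, hPMarkov x, hfam]
end

section
/- (Lower bound on the VC-dimension of the k-cylinder sets.) Let Ω = Ω_1 × ⋯ × Ω_n be a product of finite sets with |Ω_i| ≥ 2 for all i, and let 1 ≤ k ≤ n. Then the family S of all k-cylinders in Ω shatters some set of cardinality ⌊log₂(n − k + 1)⌋; in particular the VC-dimension of S is at least ⌊log₂(n − k + 1)⌋. -/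
/-- A `k`-cylinder in `Ω = Ω_1 × ⋯ × Ω_n`: the set of points whose coordinates on
some `k`-element index set `J` take prescribed values (given by a reference point
`a`). -/
def IsCylinder {n : ℕ} {Ω : Fin n → Type*} (k : ℕ) (M : Set (∀ i, Ω i)) : Prop :=
  ∃ (J : Finset (Fin n)) (a : ∀ i, Ω i),
    J.card = k ∧ M = {ω : ∀ i, Ω i | ∀ i ∈ J, ω i = a i}

/-- Family `S` of subsets of `α` shatters a finite set `F`: every subset of `F` is
cut out as `M ∩ F` for some `M ∈ S`. -/
def Shatters {α : Type*} (S : Set (Set α)) (F : Finset α) : Prop :=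
  ∀ T ⊆ F, ∃ M ∈ S, (T : Set α) = M ∩ (F : Set α)

/-- **lower bound on the VC-dimension of the `k`-cylinder sets.**
If each `Ω_i` has at least two elements and `1 ≤ k ≤ n`, then the family of
`k`-cylinders shatters some set of cardinality `⌊log₂ (n - k + 1)⌋`; in particular
its VC-dimension is at least `⌊log₂ (n - k + 1)⌋`. -/
theorem vc_dimension_of_cylinders_lower_bound
    {n k : ℕ} (hk : 1 ≤ k) (hkn : k ≤ n)
    {Ω : Fin n → Type*} [∀ i, Fintype (Ω i)] [∀ i, DecidableEq (Ω i)]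
    (hcard : ∀ i, 2 ≤ Fintype.card (Ω i)) :
    ∃ F : Finset (∀ i, Ω i), F.card = Nat.log 2 (n - k + 1) ∧
      Shatters {M : Set (∀ i, Ω i) | IsCylinder k M} F := by
  set d := Nat.log 2 (n - k + 1)
  have hpow : 2 ^ d ≤ n - k + 1 := Nat.pow_log_le_self 2 (Nat.succ_ne_zero _)
  have hne : ∀ i, ∃ p : Ω i × Ω i, p.1 ≠ p.2 := fun i => by
    obtain ⟨u, v, huv⟩ := Fintype.one_lt_card_iff.mp (hcard i)
    exact ⟨(u, v), huv⟩
  choose p hp using hne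
  obtain ⟨P, -, hP⟩ := Finset.exists_subset_card_eq
    (s := (Finset.univ : Finset (Fin n))) (n := k - 1) (by rw [Finset.card_fin]; omega)
  obtain ⟨e⟩ : Nonempty (Finset (Fin d) ↪ ((Pᶜ : Finset (Fin n)) : Type)) := by
    apply Function.Embedding.nonempty_of_card_le
    rw [Fintype.card_finset, Fintype.card_fin, Fintype.card_coe, Finset.card_compl,
      Fintype.card_fin, hP]
    omega
  have heP : ∀ A, (e A : Fin n) ∉ P := fun A => Finset.mem_compl.mp (e A).2
  classical
  let x : Fin d → ∀ i, Ω i := fun j i =>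
    if ∃ A, (e A : Fin n) = i ∧ j ∈ A then (p i).1 else (p i).2
  have hxe : ∀ j A, x j (e A) = (p (e A)).1 ↔ j ∈ A := by
    intro j A
    by_cases hj : j ∈ A
    · simp [x, hj]
    · simp [x, hj, (hp (e A)).symm]
  have hxP : ∀ j, ∀ i ∈ P, x j i = (p i).2 := by
    intro j i hi
    refine if_neg ?_
    rintro ⟨A, rfl, -⟩
    exact heP A hi
  have hinj : Function.Injective x := by
    intro j l hjl
    have hl : l ∈ ({j} : Finset (Fin d)) := by
      rw [← hxe, ← hjl, hxe]
      exact Finset.mem_singleton_self j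
    exact (Finset.mem_singleton.mp hl).symm
  refine ⟨Finset.univ.map ⟨x, hinj⟩, by simp, fun T hT => ?_⟩
  let A : Finset (Fin d) := {j | x j ∈ T}
  refine ⟨_, ⟨insert (e A : Fin n) P, fun i => if i ∈ P then (p i).2 else (p i).1, ?_, rfl⟩, ?_⟩
  · rw [Finset.card_insert_of_notMem (heP A), hP]
    omega
  · have hmem : ∀ j, (∀ i ∈ insert (e A : Fin n) P,
        x j i = if i ∈ P then (p i).2 else (p i).1) ↔ x j ∈ T := by
      intro j
      rw [Finset.forall_mem_insert, if_neg (heP A), hxe]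
      have hrest : ∀ i ∈ P, x j i = if i ∈ P then (p i).2 else (p i).1 := fun i hi => by
        rw [if_pos hi, hxP j i hi]
      simp only [A, Finset.mem_filter_univ, and_iff_left hrest]
    ext ω
    constructor
    · intro hω
      have hF := hT hω
      obtain ⟨j, -, rfl⟩ := Finset.mem_map.mp hF
      exact ⟨(hmem j).mpr hω, hF⟩
    · rintro ⟨hω, hF⟩
      obtain ⟨j, -, rfl⟩ := Finset.mem_map.mp hF
      exact (hmem j).mp hω
end

section
/- (Final theorem: linear sample size suffices for uniform estimation of all k-tuple probabilities.) Fix ε > 0, δ ∈ (0,1), an integer k ≥ 1 and an integer d ≥ 2. There exists a constant C > 0 such that for every n ≥ k, every product Ω = Ω_1 × ⋯ × Ω_n of nonempty finite sets with |Ω_i| ≤ d for all i, every probability measure P on Ω, and every integer sample size l ≥ C·n, the probability under the product measure P^{⊗l} that there exists a k-cylinder M in Ω whose empirical frequency f(M) satisfies |f(M) − P(M)| ≥ ε is less than δ. -/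
/-- Weighted moment generating function bound for a centred function with values in `[-1, 1]`. -/
lemma sum_weight_mul_exp_le {α : Type*} [Fintype α] {P g : α → ℝ} (hP : ∀ x, 0 ≤ P x)
    (hP1 : ∑ x, P x = 1) (hg : ∀ x, |g x| ≤ 1) (hg0 : ∑ x, P x * g x = 0)
    {t : ℝ} (ht0 : 0 ≤ t) (ht1 : t ≤ 1) :
    ∑ x, P x * Real.exp (t * g x) ≤ Real.exp (t ^ 2) := by
  have key : ∀ x, P x * Real.exp (t * g x) ≤ P x * (1 + t ^ 2) + t * (P x * g x) := by
    intro x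
    have habs : |t * g x| ≤ 1 := by
      rw [abs_mul, abs_of_nonneg ht0]
      exact mul_le_one₀ ht1 (abs_nonneg _) (hg x)
    have h1 := (abs_le.1 (Real.abs_exp_sub_one_sub_id_le habs)).2
    have h2 : (t * g x) ^ 2 ≤ t ^ 2 := by
      rw [mul_pow]
      exact mul_le_of_le_one_right (sq_nonneg t) ((sq_le_one_iff_abs_le_one _).2 (hg x))
    calc P x * Real.exp (t * g x) ≤ P x * (1 + t ^ 2 + t * g x) :=
          mul_le_mul_of_nonneg_left (by linarith) (hP x)
      _ = P x * (1 + t ^ 2) + t * (P x * g x) := by ring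
  calc ∑ x, P x * Real.exp (t * g x) ≤ ∑ x, (P x * (1 + t ^ 2) + t * (P x * g x)) :=
        Finset.sum_le_sum fun x _ => key x
    _ = t ^ 2 + 1 := by
        rw [Finset.sum_add_distrib, ← Finset.sum_mul, ← Finset.mul_sum, hP1, hg0]
        ring
    _ ≤ Real.exp (t ^ 2) := Real.add_one_le_exp _

/-- One-sided Chernoff bound for the sum of `l` independent samples of a centred function with
values in `[-1, 1]`. -/
lemma sum_indicator_prod_le_exp {α : Type*} [Fintype α] {P g : α → ℝ} (hP : ∀ x, 0 ≤ P x)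
    (hP1 : ∑ x, P x = 1) (hg : ∀ x, |g x| ≤ 1) (hg0 : ∑ x, P x * g x = 0)
    {t ε : ℝ} (ht0 : 0 ≤ t) (ht1 : t ≤ 1) (htε : t ≤ ε / 2) (l : ℕ) :
    ∑ ω : Fin l → α, Set.indicator {ω : Fin l → α | l * ε ≤ ∑ i, g (ω i)}
        (fun ω => ∏ i, P (ω i)) ω ≤ Real.exp (-(t * ε / 2)) ^ l := by
  have hpt : ∀ ω : Fin l → α, Set.indicator {ω : Fin l → α | l * ε ≤ ∑ i, g (ω i)}
      (fun ω => ∏ i, P (ω i)) ω ≤ ∏ i, P (ω i) * Real.exp (t * g (ω i) - t * ε) := by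
    intro ω
    refine Set.indicator_apply_le' (fun h => ?_) fun _ =>
      Finset.prod_nonneg fun i _ => mul_nonneg (hP _) (Real.exp_pos _).le
    rw [Finset.prod_mul_distrib, ← Real.exp_sum]
    refine le_mul_of_one_le_right (Finset.prod_nonneg fun i _ => hP _) (Real.one_le_exp ?_)
    rw [Finset.sum_sub_distrib, ← Finset.mul_sum]
    simp only [Finset.sum_const, Finset.card_univ, Fintype.card_fin, nsmul_eq_mul]
    have := mul_le_mul_of_nonneg_left h ht0
    linarith
  have hone : ∑ x, P x * Real.exp (t * g x - t * ε) ≤ Real.exp (-(t * ε / 2)) := by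
    calc ∑ x, P x * Real.exp (t * g x - t * ε)
        = (∑ x, P x * Real.exp (t * g x)) * Real.exp (-(t * ε)) := by
          rw [Finset.sum_mul]
          refine Finset.sum_congr rfl fun x _ => ?_
          rw [sub_eq_add_neg, Real.exp_add, mul_assoc]
      _ ≤ Real.exp (t ^ 2) * Real.exp (-(t * ε)) :=
          mul_le_mul_of_nonneg_right (sum_weight_mul_exp_le hP hP1 hg hg0 ht0 ht1)
            (Real.exp_pos _).le
      _ ≤ Real.exp (-(t * ε / 2)) := by
          rw [← Real.exp_add]
          exact Real.exp_le_exp.2 (by nlinarith)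
  calc _ ≤ ∑ ω : Fin l → α, ∏ i, P (ω i) * Real.exp (t * g (ω i) - t * ε) :=
        Finset.sum_le_sum fun ω _ => hpt ω
    _ = (∑ x, P x * Real.exp (t * g x - t * ε)) ^ l :=
        (Fintype.sum_pow (fun x => P x * Real.exp (t * g x - t * ε)) l).symm
    _ ≤ _ := pow_le_pow_left₀
        (Finset.sum_nonneg fun x _ => mul_nonneg (hP x) (Real.exp_pos _).le) hone l

/-- Concentration of the empirical frequency of a single event. -/
lemma sum_indicator_abs_frequency_sub_le {α : Type*} [Fintype α] {P : α → ℝ}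
    (hP : ∀ x, 0 ≤ P x) (hP1 : ∑ x, P x = 1) (M : Set α)
    {t ε : ℝ} (ht0 : 0 ≤ t) (ht1 : t ≤ 1) (htε : t ≤ ε / 2) {l : ℕ} (hl : 0 < l) :
    ∑ ω : Fin l → α, Set.indicator
        {ω : Fin l → α | ε ≤ |(∑ i, M.indicator (fun _ => (1 : ℝ)) (ω i)) / l -
          ∑ x, M.indicator P x|} (fun ω => ∏ i, P (ω i)) ω
      ≤ 2 * Real.exp (-(t * ε / 2)) ^ l := by
  classical
  set p := ∑ x, M.indicator P x with hp
  set g : α → ℝ := fun x => M.indicator (fun _ => (1 : ℝ)) x - p with hgdef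
  have hp0 : 0 ≤ p := Finset.sum_nonneg fun x _ => Set.indicator_nonneg (fun y _ => hP y) x
  have hp1 : p ≤ 1 := hP1 ▸ Finset.sum_le_sum fun x _ => Set.indicator_le_self' (fun y _ => hP y) x
  have hg : ∀ x, |g x| ≤ 1 := by
    intro x
    by_cases hx : x ∈ M <;> simp only [hgdef, hx, Set.indicator_of_mem, Set.indicator_of_notMem,
      not_false_eq_true, abs_le] <;> constructor <;> linarith
  have hg0 : ∑ x, P x * g x = 0 := by
    have h : ∀ x, P x * g x = M.indicator P x - P x * p := by
      intro x
      by_cases hx : x ∈ M <;> simp [hgdef, hx, mul_sub]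
    simp only [h, Finset.sum_sub_distrib, ← Finset.sum_mul, hP1, ← hp]
    ring
  have hpos := sum_indicator_prod_le_exp hP hP1 hg hg0 ht0 ht1 htε l
  have hneg := sum_indicator_prod_le_exp (g := fun x => -g x) hP hP1 (by simpa using hg)
    (by simpa using hg0) ht0 ht1 htε l
  have hl' : (0 : ℝ) < l := Nat.cast_pos.2 hl
  have hsum : ∀ ω : Fin l → α, ∑ i, g (ω i) =
      l * ((∑ i, M.indicator (fun _ => (1 : ℝ)) (ω i)) / l - p) := by
    intro ω
    simp only [hgdef, Finset.sum_sub_distrib, Finset.sum_const, Finset.card_univ,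
      Fintype.card_fin, nsmul_eq_mul]
    field_simp
  have hprod : ∀ ω : Fin l → α, 0 ≤ ∏ i, P (ω i) := fun ω => Finset.prod_nonneg fun i _ => hP _
  rw [two_mul]
  refine le_trans ?_ (add_le_add hpos hneg)
  rw [← Finset.sum_add_distrib]
  refine Finset.sum_le_sum fun ω _ => Set.indicator_apply_le' (fun h => ?_) fun _ =>
    add_nonneg (Set.indicator_nonneg (fun ω _ => hprod ω) ω)
      (Set.indicator_nonneg (fun ω _ => hprod ω) ω)
  rcases le_abs.1 (Set.mem_ofPred_eq ▸ h) with h | h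
  · rw [Set.indicator_of_mem (s := {ω : Fin l → α | l * ε ≤ ∑ i, g (ω i)})]
    · exact le_add_of_nonneg_right (Set.indicator_nonneg (fun ω _ => hprod ω) ω)
    · rw [Set.mem_ofPred_eq, hsum]
      exact mul_le_mul_of_nonneg_left h hl'.le
  · rw [Set.indicator_of_mem (s := {ω : Fin l → α | l * ε ≤ ∑ i, -g (ω i)})]
    · exact le_add_of_nonneg_left (Set.indicator_nonneg (fun ω _ => hprod ω) ω)
    · rw [Set.mem_ofPred_eq, Finset.sum_neg_distrib, hsum, ← mul_neg]
      exact mul_le_mul_of_nonneg_left h hl'.le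

/-- Union bound over a finite family of events for a nonnegative weight. -/
lemma sum_indicator_le_sum_sum_indicator {β ι : Type*} [Fintype β] [Fintype ι] {w : β → ℝ}
    (hw : ∀ b, 0 ≤ w b) {A : Set β} {B : ι → Set β} (hAB : A ⊆ ⋃ j, B j) :
    ∑ b, A.indicator w b ≤ ∑ j, ∑ b, (B j).indicator w b := by
  rw [Finset.sum_comm]
  have hnn : ∀ b j, 0 ≤ (B j).indicator w b := fun b j => Set.indicator_nonneg (fun b _ => hw b) b
  refine Finset.sum_le_sum fun b _ => Set.indicator_apply_le' (fun h => ?_) fun _ =>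
    Finset.sum_nonneg fun j _ => hnn b j
  obtain ⟨j, hj⟩ := Set.mem_iUnion.1 (hAB h)
  calc w b = (B j).indicator w b := (Set.indicator_of_mem hj w).symm
    _ ≤ ∑ j, (B j).indicator w b :=
      Finset.single_le_sum (fun j _ => hnn b j) (Finset.mem_univ j)

/-- **final theorem: linear sample size suffices.**
Fix `ε > 0`, `δ ∈ (0,1)`, `k ≥ 1` and `d ≥ 2`.  There is a constant `C > 0` such
that for every `n ≥ k`, every product `Ω = Ω_1 × ⋯ × Ω_n` of nonempty finite sets
of size at most `d`, every probability distribution `P` on `Ω`, and every sample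
size `l ≥ C·n`, the probability — under the `l`-fold product of `P` (the weight of
a sample `ω = (ω^1,…,ω^l)` is `∏ i, P(ω^i)`) — of the event that some `k`-cylinder
`M` has empirical frequency `f(M) = |{i : ω^i ∈ M}|/l` deviating from
`P(M) = ∑_{x ∈ M} P(x)` by at least `ε`, is less than `δ`. -/
theorem linear_sample_size_suffices
    (ε δ : ℝ) (hε : 0 < ε) (hδ0 : 0 < δ) (hδ1 : δ < 1)
    (k d : ℕ) (hk : 1 ≤ k) (hd : 2 ≤ d) :
    ∃ C : ℝ, 0 < C ∧
      ∀ (n : ℕ), k ≤ n →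
      ∀ (Ω : Fin n → Type) [∀ i, Fintype (Ω i)] [∀ i, Nonempty (Ω i)],
        (∀ i, Fintype.card (Ω i) ≤ d) →
      ∀ P : (∀ i, Ω i) → ℝ, (∀ x, 0 ≤ P x) → ∑ x, P x = 1 →
      ∀ l : ℕ, C * n ≤ l →
        ∑ ω : Fin l → (∀ i, Ω i),
          Set.indicator
            {ω : Fin l → (∀ i, Ω i) |
              ∃ M : Set (∀ i, Ω i), IsCylinder k M ∧
                ε ≤ |(∑ i : Fin l, M.indicator (fun _ => (1 : ℝ)) (ω i)) / l -
                      ∑ x, M.indicator P x|}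
            (fun ω => ∏ i : Fin l, P (ω i)) ω
          < δ := by
  set t := min 1 (ε / 2) with ht
  have ht0 : 0 < t := lt_min one_pos (half_pos hε)
  have hc : 0 < t * ε / 2 := by positivity
  have hd' : (2 : ℝ) ≤ d := by exact_mod_cast hd
  have hr : 1 < 8 * d / δ := by rw [one_lt_div hδ0]; linarith
  refine ⟨Real.log (8 * d / δ) / (t * ε / 2), div_pos (Real.log_pos hr) hc, ?_⟩
  intro n hn Ω _ _ hcard P hP hP1 l hl
  have hn0 : n ≠ 0 := by omega
  have hn1 : (0 : ℝ) < n := by exact_mod_cast Nat.pos_of_ne_zero hn0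
  have hl0 : 0 < l := by
    have : (0 : ℝ) < l := (mul_pos (div_pos (Real.log_pos hr) hc) hn1).trans_le hl
    exact_mod_cast this
  have hexp : Real.exp (-(t * ε / 2)) ^ l ≤ (δ / (8 * d)) ^ n := by
    have h1 : Real.log (8 * d / δ) * n ≤ l * (t * ε / 2) := by
      rwa [div_mul_eq_mul_div, div_le_iff₀ hc] at hl
    calc Real.exp (-(t * ε / 2)) ^ l = Real.exp (-(l * (t * ε / 2))) := by
          rw [← Real.exp_nat_mul, mul_neg]
      _ ≤ Real.exp (n * (-Real.log (8 * d / δ))) := Real.exp_le_exp.2 (by linarith)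
      _ = (δ / (8 * d)) ^ n := by
          rw [Real.exp_nat_mul, Real.exp_neg, Real.exp_log (one_pos.trans hr), inv_div]
  have hcount : (Fintype.card (Finset (Fin n) × (∀ i, Ω i)) : ℝ) ≤ (2 * d) ^ n := by
    have h : Fintype.card (Finset (Fin n) × (∀ i, Ω i)) ≤ (2 * d) ^ n := by
      rw [Fintype.card_prod, Fintype.card_finset, Fintype.card_fin, Fintype.card_pi, mul_pow]
      refine Nat.mul_le_mul_left _ ?_
      simpa using Finset.prod_le_pow_card Finset.univ (fun i => Fintype.card (Ω i)) d
        fun i _ => hcard i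
    exact_mod_cast h
  refine (sum_indicator_le_sum_sum_indicator (ι := Finset (Fin n) × (∀ i, Ω i))
    (B := fun q => {ω | ε ≤ |(∑ i : Fin l, Set.indicator {x : ∀ i, Ω i | ∀ i ∈ q.1, x i = q.2 i}
      (fun _ => (1 : ℝ)) (ω i)) / l -
        ∑ x, Set.indicator {x : ∀ i, Ω i | ∀ i ∈ q.1, x i = q.2 i} P x|})
    (fun ω => Finset.prod_nonneg fun i _ => hP _) ?_).trans_lt ?_
  · rintro ω ⟨M, ⟨J, a, -, rfl⟩, h⟩
    exact Set.mem_iUnion.2 ⟨(J, a), h⟩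
  calc _ ≤ ∑ _q : Finset (Fin n) × (∀ i, Ω i), 2 * Real.exp (-(t * ε / 2)) ^ l :=
        Finset.sum_le_sum fun q _ => sum_indicator_abs_frequency_sub_le hP hP1 _ ht0.le
          (min_le_left _ _) (min_le_right _ _) hl0
    _ = Fintype.card (Finset (Fin n) × (∀ i, Ω i)) * (2 * Real.exp (-(t * ε / 2)) ^ l) := by
        rw [Finset.sum_const, Finset.card_univ, nsmul_eq_mul]
    _ ≤ (2 * d) ^ n * (2 * (δ / (8 * d)) ^ n) := by gcongr
    _ = 2 * (δ / 4) ^ n := by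
        rw [mul_left_comm, ← mul_pow]
        congr 2
        field_simp
        norm_num
    _ ≤ 2 * (δ / 4) := by
        gcongr
        exact pow_le_of_le_one (by positivity) (by linarith) hn0
    _ < δ := by linarith
end
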